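/- Let J be the 4×4 complex matrix J = [[0, ρ],[ρ*, 0]] with ρ = [[0,1],[−1,0]]. Let z₀ < z₁ be reals, let A : [z₀, z₁] → M₄(ℂ) be continuous with Im A(z) := (A(z) − A(z)*)/(2i) positive definite for every z, and let Ψ : [z₀, z₁] → M₄(ℂ) be differentiable with Ψ'(z) = iJA(z)Ψ(z) and Ψ(z₀) = I. Then the matrix J − Ψ(z₁)* J Ψ(z₁) is positive definite. -/

import Mathlib

open Matrix Complex
open scoped ComplexOrder

/-- The imaginary part `Im M := (M − M*)/(2i)` of a square complex matrix. -/
noncomputable def imPart {n : Type*} [Fintype n] (M : Matrix n n ℂ) : Matrix n n ℂ :=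
  ((2 : ℂ) * Complex.I)⁻¹ • (M - Mᴴ)

/-- The matrix `ρ = [[0,1],[−1,0]]`. -/
noncomputable def rhoMat : Matrix (Fin 2) (Fin 2) ℂ := !![0, 1; -1, 0]

/-- The matrix `J = [[0, ρ],[ρ*, 0]]`. -/
noncomputable def Jmat : Matrix (Fin 2 ⊕ Fin 2) (Fin 2 ⊕ Fin 2) ℂ :=
  Matrix.fromBlocks 0 rhoMat rhoMatᴴ 0

theorem HasDerivWithinAt.star_dotProduct_mulVec {n : Type*} [Fintype n] {M : Matrix n n ℂ}
    {v : ℝ → n → ℂ} {v' : n → ℂ} {s : Set ℝ} {t : ℝ} (hv : HasDerivWithinAt v v' s t) :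
    HasDerivWithinAt (fun t => star (v t) ⬝ᵥ M *ᵥ v t)
      (star v' ⬝ᵥ M *ᵥ v t + star (v t) ⬝ᵥ M *ᵥ v') s t := by
  have hv_apply := hasDerivWithinAt_pi.1 hv
  simp only [dotProduct, mulVec, ← Finset.sum_add_distrib]
  exact HasDerivWithinAt.fun_sum fun i _ => (hv_apply i).star.mul
    (HasDerivWithinAt.fun_sum fun j _ => (hv_apply j).const_mul (M i j))

theorem rhoMat_mul_conjTranspose : rhoMat * rhoMatᴴ = 1 := by
  ext i j
  fin_cases i <;> fin_cases j <;> simp [rhoMat, Matrix.mul_apply]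

theorem Jmat_conjTranspose : Jmatᴴ = Jmat := by
  simp [Jmat, fromBlocks_conjTranspose]

theorem Jmat_mul_self : Jmat * Jmat = 1 := by
  simp [Jmat, fromBlocks_multiply, rhoMat_mul_conjTranspose,
    mul_eq_one_comm.1 rhoMat_mul_conjTranspose]

theorem two_smul_imPart {n : Type*} [Fintype n] (M : Matrix n n ℂ) :
    (2 : ℂ) • imPart M = -(Complex.I • (M - Mᴴ)) := by
  rw [imPart, smul_smul, ← neg_smul]
  congr 1
  simp [mul_left_comm]

/-- If `v' = iJAv` with `J* = J = J⁻¹`, then the derivative of `v*Jv` is `−2 v*(Im A)v`. -/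
theorem hasDerivWithinAt_star_dotProduct_mulVec_of_ode {n : Type*} [Fintype n] [DecidableEq n]
    {J A : Matrix n n ℂ} (hJ : Jᴴ = J) (hJJ : J * J = 1) {v : ℝ → n → ℂ} {s : Set ℝ} {t : ℝ}
    (hv : HasDerivWithinAt v (Complex.I • (J * A) *ᵥ v t) s t) :
    HasDerivWithinAt (fun t => star (v t) ⬝ᵥ J *ᵥ v t)
      (-(2 * (star (v t) ⬝ᵥ imPart A *ᵥ v t))) s t := by
  convert hv.star_dotProduct_mulVec (M := J) using 1
  have hleft : star (Complex.I • (J * A) *ᵥ v t) ⬝ᵥ J *ᵥ v t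
      = -(Complex.I * (star (v t) ⬝ᵥ Aᴴ *ᵥ v t)) := by
    rw [star_smul, star_mulVec, smul_dotProduct, ← dotProduct_mulVec, mulVec_mulVec,
      conjTranspose_mul, hJ, Matrix.mul_assoc, hJJ, Matrix.mul_one]
    simp
  have hright : star (v t) ⬝ᵥ J *ᵥ (Complex.I • (J * A) *ᵥ v t)
      = Complex.I * (star (v t) ⬝ᵥ A *ᵥ v t) := by
    rw [mulVec_smul, mulVec_mulVec, ← Matrix.mul_assoc, hJJ, Matrix.one_mul, dotProduct_smul,
      smul_eq_mul]
  rw [hleft, hright, ← smul_eq_mul 2, ← dotProduct_smul, ← smul_mulVec, two_smul_imPart]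
  simp only [neg_mulVec, smul_mulVec, sub_mulVec, dotProduct_neg, dotProduct_smul,
    dotProduct_sub, smul_eq_mul]
  ring

theorem lt_of_hasDerivWithinAt_nonpos_of_left_neg {f f' : ℝ → ℝ} {a b : ℝ} (hab : a < b)
    (hf : ∀ t ∈ Set.Icc a b, HasDerivWithinAt f (f' t) (Set.Icc a b) t)
    (hf' : ∀ t ∈ Set.Icc a b, f' t ≤ 0) (ha : f' a < 0) : f b < f a := by
  have hmem : a ∈ Set.Icc a b := Set.left_mem_Icc.2 hab.le
  have hanti : AntitoneOn f (Set.Icc a b) :=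
    antitoneOn_of_hasDerivWithinAt_nonpos (convex_Icc a b)
      (fun t ht => (hf t ht).continuousWithinAt)
      (fun t ht => (hf t (interior_subset ht)).mono interior_subset)
      (fun t ht => hf' t (interior_subset ht))
  refine (hanti hmem (Set.right_mem_Icc.2 hab.le) hab.le).lt_of_ne fun heq => ha.ne ?_
  have hconst : ∀ t ∈ Set.Icc a b, f t = f a := fun t ht =>
    le_antisymm (hanti hmem ht ht.1) (heq ▸ hanti ht (Set.right_mem_Icc.2 hab.le) ht.2)
  exact (uniqueDiffOn_Icc hab a hmem).eq_deriv _ (hf a hmem)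
    ((hasDerivWithinAt_const a _ (f a)).congr_of_mem hconst hmem)

/-- If `Im A(z)` is positive definite for every `z` and `Ψ` is the transfer matrix of the
ODE `Ψ' = iJAΨ`, `Ψ(z₀) = I`, then `J − Ψ(z₁)*JΨ(z₁)` is positive definite. -/
theorem posDef_J_sub_transfer (z₀ z₁ : ℝ) (hz : z₀ < z₁)
    (A : ℝ → Matrix (Fin 2 ⊕ Fin 2) (Fin 2 ⊕ Fin 2) ℂ)
    (hA : ContinuousOn A (Set.Icc z₀ z₁))
    (hApos : ∀ z ∈ Set.Icc z₀ z₁, (imPart (A z)).PosDef)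
    (Ψ : ℝ → Matrix (Fin 2 ⊕ Fin 2) (Fin 2 ⊕ Fin 2) ℂ)
    (hΨ : ∀ z ∈ Set.Icc z₀ z₁, ∀ i j,
      HasDerivWithinAt (fun t => Ψ t i j) ((Complex.I • (Jmat * A z * Ψ z)) i j)
        (Set.Icc z₀ z₁) z)
    (hΨ0 : Ψ z₀ = 1) :
    (Jmat - (Ψ z₁)ᴴ * Jmat * Ψ z₁).PosDef := by
  have hherm : (Jmat - (Ψ z₁)ᴴ * Jmat * Ψ z₁).IsHermitian := by
    simp [IsHermitian, conjTranspose_mul, Jmat_conjTranspose, Matrix.mul_assoc]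
  refine PosDef.of_dotProduct_mulVec_pos hherm fun {x} hx => ?_
  set v : ℝ → (Fin 2 ⊕ Fin 2) → ℂ := fun t => Ψ t *ᵥ x with hv
  have hv0 : v z₀ = x := by simp [hv, hΨ0]
  have hvderiv : ∀ z ∈ Set.Icc z₀ z₁,
      HasDerivWithinAt v (Complex.I • (Jmat * A z) *ᵥ v z) (Set.Icc z₀ z₁) z := by
    intro z hz'
    rw [hv, mulVec_mulVec, ← smul_mulVec, hasDerivWithinAt_pi]
    intro i
    simp only [mulVec, dotProduct]
    exact HasDerivWithinAt.fun_sum fun j _ => (hΨ z hz' i j).mul_const (x j)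
  have hlt : (star (v z₁) ⬝ᵥ Jmat *ᵥ v z₁).re < (star (v z₀) ⬝ᵥ Jmat *ᵥ v z₀).re := by
    refine lt_of_hasDerivWithinAt_nonpos_of_left_neg hz
      (f := fun t => (star (v t) ⬝ᵥ Jmat *ᵥ v t).re)
      (f' := fun t => (-(2 * (star (v t) ⬝ᵥ imPart (A t) *ᵥ v t))).re) (fun z hz' => ?_)
      (fun z hz' => ?_) ?_
    · exact Complex.reCLM.hasFDerivAt.comp_hasDerivWithinAt z
        (hasDerivWithinAt_star_dotProduct_mulVec_of_ode Jmat_conjTranspose Jmat_mul_self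
          (hvderiv z hz'))
    · have := (Complex.le_def.1 ((hApos z hz').posSemidef.dotProduct_mulVec_nonneg (v z))).1
      simpa using this
    · have := (Complex.lt_def.1
        ((hApos z₀ (Set.left_mem_Icc.2 hz.le)).dotProduct_mulVec_pos (hv0.symm ▸ hx))).1
      simpa using this
  have hform : star x ⬝ᵥ (Jmat - (Ψ z₁)ᴴ * Jmat * Ψ z₁) *ᵥ x
      = star (v z₀) ⬝ᵥ Jmat *ᵥ v z₀ - star (v z₁) ⬝ᵥ Jmat *ᵥ v z₁ := by
    rw [hv0, hv, sub_mulVec, dotProduct_sub, star_mulVec, ← dotProduct_mulVec, mulVec_mulVec,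
      mulVec_mulVec, Matrix.mul_assoc]
  refine Complex.lt_def.2 ⟨?_, (hherm.im_star_dotProduct_mulVec_self x).symm⟩
  rw [hform]
  simpa using hlt
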